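/- arXiv:1903.05812 — 2 statements merged into one kernel-verified Lean document; each statement's English description precedes it below -/
import Mathlib

section
/- Let A be a row-stochastic matrix on a finite set S with Dobrushin coefficient σ(A) > 0. Then there exists a unique probability vector μ* on S with μ* = μ*A, and for every probability vector μ₀ and every k ∈ ℕ one has ‖μ₀Aᵏ − μ*‖₁ ≤ (1 − σ(A))ᵏ · ‖μ₀ − μ*‖₁; in particular μ₀Aᵏ → μ* as k → ∞. -/
/-- The Dobrushin coefficient of a kernel `A` on a finite set `S`:
`σ(A) = min_{s,s'} Σ_t min(A s t, A s' t)`. -/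
noncomputable def dobrushin {S : Type*} [Fintype S] [Nonempty S] (A : S → S → ℝ) : ℝ :=
  ⨅ p : S × S, ∑ t, min (A p.1 t) (A p.2 t)

open Matrix in
/-- The sum of the entries is invariant under right multiplication by a matrix with unit row sums. -/
theorem sum_vecMul_of_row_sum_one {S : Type*} [Fintype S] {A : Matrix S S ℝ}
    (hA1 : ∀ s, ∑ t, A s t = 1) (v : S → ℝ) : ∑ t, (v ᵥ* A) t = ∑ s, v s := by
  simp only [vecMul, dotProduct]
  rw [Finset.sum_comm]
  simp [← Finset.mul_sum, hA1]

theorem dobrushin_le {S : Type*} [Fintype S] [Nonempty S] (A : S → S → ℝ) (s s' : S) :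
    dobrushin A ≤ ∑ t, min (A s t) (A s' t) :=
  ciInf_le (Set.finite_range fun p : S × S => ∑ t, min (A p.1 t) (A p.2 t)).bddBelow (s, s')

theorem dobrushin_le_one {S : Type*} [Fintype S] [Nonempty S] {A : S → S → ℝ}
    (hA1 : ∀ s, ∑ t, A s t = 1) : dobrushin A ≤ 1 := by
  obtain ⟨s⟩ := ‹Nonempty S›
  simpa [hA1] using dobrushin_le A s s

/-- Rows of a stochastic matrix are at `ℓ¹` distance at most `2 (1 - σ(A))`. -/
theorem sum_abs_row_sub_le {S : Type*} [Fintype S] [Nonempty S] {A : S → S → ℝ}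
    (hA1 : ∀ s, ∑ t, A s t = 1) (s s' : S) :
    ∑ t, |A s t - A s' t| ≤ 2 * (1 - dobrushin A) := by
  have h : ∀ t, |A s t - A s' t| = A s t + A s' t - 2 * min (A s t) (A s' t) := fun t => by
    grind
  simp only [h, Finset.sum_sub_distrib, Finset.sum_add_distrib, hA1, ← Finset.mul_sum]
  linarith [dobrushin_le A s s']

open Matrix in
/-- A stochastic matrix contracts the `ℓ¹` norm of zero-sum vectors by the factor `1 - σ(A)`. -/
theorem sum_abs_vecMul_le_of_sum_eq_zero {S : Type*} [Fintype S] [Nonempty S] {A : Matrix S S ℝ}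
    (hA1 : ∀ s, ∑ t, A s t = 1) {v : S → ℝ} (hv : ∑ s, v s = 0) :
    ∑ t, |(v ᵥ* A) t| ≤ (1 - dobrushin A) * ∑ s, |v s| := by
  set m := ∑ s, (v s)⁺ with hm
  have hneg : ∑ s, (v s)⁻ = m := by
    have : ∑ s, ((v s)⁺ - (v s)⁻) = 0 := by simpa only [posPart_sub_negPart] using hv
    rw [Finset.sum_sub_distrib] at this
    linarith
  have habs : ∑ s, |v s| = 2 * m := by
    simp only [← posPart_add_negPart, Finset.sum_add_distrib, hneg]
    linarith
  have hm0 : 0 ≤ m := Finset.sum_nonneg fun s _ => posPart_nonneg _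
  rcases hm0.eq_or_lt with h0 | hpos
  · have hz : v = 0 := by
      rw [← h0, mul_zero, Finset.sum_eq_zero_iff_of_nonneg fun s _ => abs_nonneg _] at habs
      exact funext fun s => abs_eq_zero.1 (habs s (Finset.mem_univ s))
    simp [hz]
  have hcoupling : ∀ t, m * (v ᵥ* A) t =
      ∑ s, ∑ s', (v s)⁺ * (v s')⁻ * (A s t - A s' t) := fun t => by
    have h1 : ∑ s, ∑ s', (v s)⁺ * (v s')⁻ * A s t = m * ∑ s, (v s)⁺ * A s t := by
      rw [← hneg, Finset.sum_mul_sum, Finset.sum_comm]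
      exact Finset.sum_congr rfl fun s _ => Finset.sum_congr rfl fun s' _ => by ring
    have h2 : ∑ s, ∑ s', (v s)⁺ * (v s')⁻ * A s' t = m * ∑ s, (v s)⁻ * A s t := by
      rw [hm, Finset.sum_mul_sum]
      exact Finset.sum_congr rfl fun s _ => Finset.sum_congr rfl fun s' _ => by ring
    simp only [mul_sub, Finset.sum_sub_distrib, h1, h2]
    rw [← mul_sub, ← Finset.sum_sub_distrib]
    simp only [← sub_mul, posPart_sub_negPart, vecMul, dotProduct]
  have hmul : m * ∑ t, |(v ᵥ* A) t| ≤ m * ((1 - dobrushin A) * (2 * m)) := by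
    calc m * ∑ t, |(v ᵥ* A) t|
        = ∑ t, |∑ s, ∑ s', (v s)⁺ * (v s')⁻ * (A s t - A s' t)| := by
          simp only [← hcoupling, abs_mul, abs_of_nonneg hm0, Finset.mul_sum]
      _ ≤ ∑ t, ∑ s, ∑ s', (v s)⁺ * (v s')⁻ * |A s t - A s' t| := by
          refine Finset.sum_le_sum fun t _ => (Finset.abs_sum_le_sum_abs _ _).trans <|
            Finset.sum_le_sum fun s _ => (Finset.abs_sum_le_sum_abs _ _).trans_eq <|
            Finset.sum_congr rfl fun s' _ => ?_
          rw [abs_mul, abs_of_nonneg (mul_nonneg (posPart_nonneg _) (negPart_nonneg _))]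
      _ = ∑ s, ∑ s', (v s)⁺ * (v s')⁻ * ∑ t, |A s t - A s' t| := by
          rw [Finset.sum_comm]
          refine Finset.sum_congr rfl fun s _ => ?_
          rw [Finset.sum_comm]
          simp only [Finset.mul_sum]
      _ ≤ ∑ s, ∑ s', (v s)⁺ * (v s')⁻ * (2 * (1 - dobrushin A)) :=
          Finset.sum_le_sum fun s _ => Finset.sum_le_sum fun s' _ =>
            mul_le_mul_of_nonneg_left (sum_abs_row_sub_le hA1 s s')
              (mul_nonneg (posPart_nonneg _) (negPart_nonneg _))
      _ = m * ((1 - dobrushin A) * (2 * m)) := by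
          simp only [← Finset.sum_mul, ← Finset.mul_sum, hneg, ← hm]
          ring
  rw [habs]
  exact le_of_mul_le_mul_left hmul hpos

open Matrix in
theorem sum_abs_vecMul_pow_le_of_sum_eq_zero {S : Type*} [Fintype S] [Nonempty S] [DecidableEq S]
    {A : Matrix S S ℝ} (hA1 : ∀ s, ∑ t, A s t = 1) {v : S → ℝ} (hv : ∑ s, v s = 0) (k : ℕ) :
    ∑ t, |(v ᵥ* A ^ k) t| ≤ (1 - dobrushin A) ^ k * ∑ s, |v s| := by
  induction k generalizing v with
  | zero => simp
  | succ k ih =>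
    rw [pow_succ', ← vecMul_vecMul, pow_succ, mul_assoc]
    exact (ih ((sum_vecMul_of_row_sum_one hA1 v).trans hv)).trans <|
      mul_le_mul_of_nonneg_left (sum_abs_vecMul_le_of_sum_eq_zero hA1 hv)
        (pow_nonneg (sub_nonneg.2 (dobrushin_le_one hA1)) k)

/-- The sup distance is bounded by the `ℓ¹` distance. -/
theorem dist_le_sum_abs_sub {S : Type*} [Fintype S] (x y : S → ℝ) :
    dist x y ≤ ∑ s, |x s - y s| :=
  (dist_pi_le_iff (Finset.sum_nonneg fun _ _ => abs_nonneg _)).2 fun s =>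
    Finset.single_le_sum (f := fun s => |x s - y s|) (fun _ _ => abs_nonneg _) (Finset.mem_univ s)

open Matrix in
theorem vecMul_mem_stdSimplex {S : Type*} [Fintype S] {A : Matrix S S ℝ}
    (hA0 : ∀ s t, 0 ≤ A s t) (hA1 : ∀ s, ∑ t, A s t = 1) {v : S → ℝ} (hv : v ∈ stdSimplex ℝ S) :
    v ᵥ* A ∈ stdSimplex ℝ S :=
  ⟨fun t => Finset.sum_nonneg fun s _ => mul_nonneg (hv.1 s) (hA0 s t),
    (sum_vecMul_of_row_sum_one hA1 v).trans hv.2⟩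

open Matrix Filter in
theorem exists_stationary_of_dobrushin_pos {S : Type*} [Fintype S] [Nonempty S] [DecidableEq S]
    {A : Matrix S S ℝ} (hA0 : ∀ s t, 0 ≤ A s t) (hA1 : ∀ s, ∑ t, A s t = 1)
    (hσ : 0 < dobrushin A) : ∃ μ ∈ stdSimplex ℝ S, μ ᵥ* A = μ := by
  obtain ⟨s₀⟩ := ‹Nonempty S›
  let x : ℕ → S → ℝ := fun k => Pi.single s₀ 1 ᵥ* A ^ k
  have hsucc : ∀ k, x (k + 1) = x k ᵥ* A := fun k => by simp only [x, pow_succ, vecMul_vecMul]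
  have hmem : ∀ k, x k ∈ stdSimplex ℝ S := fun k => by
    induction k with
    | zero => simpa only [x, pow_zero, vecMul_one] using single_mem_stdSimplex ℝ s₀
    | succ k ih => exact hsucc k ▸ vecMul_mem_stdSimplex hA0 hA1 ih
  have hcauchy : CauchySeq x := by
    refine cauchySeq_of_le_geometric (1 - dobrushin A) (∑ s, |(x 0 - x 1) s|) (by linarith)
      fun k => (dist_le_sum_abs_sub _ _).trans ?_
    have h0 : ∑ s, (x 0 - x 1) s = 0 := by
      simp [Finset.sum_sub_distrib, (hmem 0).2, (hmem 1).2]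
    have hk : x k - x (k + 1) = (x 0 - x 1) ᵥ* A ^ k := by
      simp only [x, sub_vecMul, vecMul_vecMul, pow_succ', pow_zero, one_mul, mul_one]
    have := sum_abs_vecMul_pow_le_of_sum_eq_zero hA1 h0 k
    rwa [← hk, mul_comm] at this
  obtain ⟨μ, hμ⟩ := cauchySeq_tendsto_of_complete hcauchy
  refine ⟨μ, (isClosed_stdSimplex ℝ S).mem_of_tendsto hμ (Eventually.of_forall hmem), ?_⟩
  have hcont : Continuous fun v : S → ℝ => v ᵥ* A := by fun_prop
  have hlim := (hcont.tendsto μ).comp hμ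
  exact tendsto_nhds_unique hlim (((tendsto_add_atTop_iff_nat 1).2 hμ).congr hsucc)

/-- If `A` is a row-stochastic matrix on a finite set `S` with `σ(A) > 0`, then there
is a unique stationary probability vector `μ*`, and for every probability vector `μ₀`
and every `k`, `‖μ₀ Aᵏ − μ*‖₁ ≤ (1 − σ(A))ᵏ ‖μ₀ − μ*‖₁`; in particular `μ₀ Aᵏ → μ*`. -/
theorem exists_unique_stationary_of_dobrushin_pos
    {S : Type*} [Fintype S] [Nonempty S] [DecidableEq S]
    (A : Matrix S S ℝ) (hA0 : ∀ s t, 0 ≤ A s t) (hA1 : ∀ s, ∑ t, A s t = 1)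
    (hσ : 0 < dobrushin A) :
    ∃ μstar : S → ℝ,
      (∀ s, 0 ≤ μstar s) ∧ (∑ s, μstar s = 1) ∧
      Matrix.vecMul μstar A = μstar ∧
      (∀ ν : S → ℝ, (∀ s, 0 ≤ ν s) → (∑ s, ν s = 1) →
        Matrix.vecMul ν A = ν → ν = μstar) ∧
      (∀ μ0 : S → ℝ, (∀ s, 0 ≤ μ0 s) → (∑ s, μ0 s = 1) →
        (∀ k : ℕ, ∑ s, |Matrix.vecMul μ0 (A ^ k) s - μstar s| ≤
            (1 - dobrushin A) ^ k * ∑ s, |μ0 s - μstar s|) ∧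
        Filter.Tendsto (fun k : ℕ => Matrix.vecMul μ0 (A ^ k)) Filter.atTop (nhds μstar)) := by
  obtain ⟨μ, hμ, hfix⟩ := exists_stationary_of_dobrushin_pos hA0 hA1 hσ
  have hr0 : 0 ≤ 1 - dobrushin A := sub_nonneg.2 (dobrushin_le_one hA1)
  have hpow : ∀ k : ℕ, Matrix.vecMul μ (A ^ k) = μ := fun k => by
    induction k with
    | zero => simp
    | succ k ih => rw [pow_succ, ← Matrix.vecMul_vecMul, ih, hfix]
  have hbound : ∀ ν : S → ℝ, ∑ s, ν s = 1 → ∀ k : ℕ,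
      ∑ s, |Matrix.vecMul ν (A ^ k) s - μ s| ≤
        (1 - dobrushin A) ^ k * ∑ s, |ν s - μ s| := fun ν hν k => by
    have h0 : ∑ s, (ν - μ) s = 0 := by simp [Finset.sum_sub_distrib, hν, hμ.2]
    simpa [Matrix.sub_vecMul, hpow] using sum_abs_vecMul_pow_le_of_sum_eq_zero hA1 h0 k
  have hlim : ∀ ν : S → ℝ, ∑ s, ν s = 1 →
      Filter.Tendsto (fun k : ℕ => Matrix.vecMul ν (A ^ k)) Filter.atTop (nhds μ) :=
    fun ν hν => by
      refine tendsto_iff_dist_tendsto_zero.2 <| squeeze_zero (fun k => dist_nonneg)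
        (fun k => (dist_le_sum_abs_sub _ _).trans (hbound ν hν k)) ?_
      simpa using (tendsto_pow_atTop_nhds_zero_of_lt_one hr0 (by linarith)).mul_const
        (∑ s, |ν s - μ s|)
  refine ⟨μ, hμ.1, hμ.2, hfix, fun ν _ hν hνfix => ?_, fun ν _ hν => ⟨hbound ν hν, hlim ν hν⟩⟩
  have hle := hbound ν hν 1
  rw [pow_one, pow_one, hνfix] at hle
  have hnonneg : 0 ≤ ∑ s, |ν s - μ s| := Finset.sum_nonneg fun s _ => abs_nonneg _
  exact dist_le_zero.1 ((dist_le_sum_abs_sub ν μ).trans (by nlinarith))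
end

section
/- Consider an n × n row-stochastic matrix A and a sequence of n × n row-stochastic matrices {A_k}_{k∈ℕ}. Fix ε ∈ (0,1) and m ∈ ℕ with m ≥ 1. If sup_{k∈ℕ} ‖A_k − A‖∞ ≤ ε/(2nm), then sup over all k ∈ ℕ and all n-dimensional probability vectors μ₀ of ‖μ₀A_kA_{k+1}⋯A_{k+m−1} − μ₀Aᵐ‖₁ is at most ε/2. -/
/-- Right multiplication by a row-stochastic matrix does not increase the `ℓ¹` norm. -/
theorem Matrix.sum_abs_vecMul_le_of_row_stochastic {S : Type*} [Fintype S]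
    {A : Matrix S S ℝ} (hA0 : ∀ s t, 0 ≤ A s t) (hA1 : ∀ s, ∑ t, A s t = 1) (v : S → ℝ) :
    ∑ t, |Matrix.vecMul v A t| ≤ ∑ s, |v s| := by
  calc ∑ t, |Matrix.vecMul v A t| ≤ ∑ t, ∑ s, |v s| * A s t := by
        refine Finset.sum_le_sum fun t _ => (Finset.abs_sum_le_sum_abs _ _).trans_eq ?_
        exact Finset.sum_congr rfl fun s _ => by rw [abs_mul, abs_of_nonneg (hA0 s t)]
    _ = ∑ s, |v s| := by
        rw [Finset.sum_comm]
        simp [← Finset.mul_sum, hA1]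

/-- The `ℓ¹` norm of `vE` is at most `n * δ * ‖v‖₁` when the entries of `E` are bounded by `δ`. -/
theorem Matrix.sum_abs_vecMul_le_of_abs_le {S : Type*} [Fintype S]
    {E : Matrix S S ℝ} {δ : ℝ} (hE : ∀ s t, |E s t| ≤ δ) (v : S → ℝ) :
    ∑ t, |Matrix.vecMul v E t| ≤ Fintype.card S * δ * ∑ s, |v s| := by
  calc ∑ t, |Matrix.vecMul v E t| ≤ ∑ _t : S, ∑ s, |v s| * δ := by
        refine Finset.sum_le_sum fun t _ => (Finset.abs_sum_le_sum_abs _ _).trans ?_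
        refine Finset.sum_le_sum fun s _ => ?_
        rw [abs_mul]
        exact mul_le_mul_of_nonneg_left (hE s t) (abs_nonneg _)
    _ = Fintype.card S * δ * ∑ s, |v s| := by
        rw [Finset.sum_const, Finset.card_univ, nsmul_eq_mul, ← Finset.sum_mul]
        ring

/-- The distance between inhomogeneous and homogeneous products grows at most linearly. -/
theorem Matrix.sum_abs_sub_vecMul_pow_le {S : Type*} [Fintype S] [DecidableEq S]
    {A : Matrix S S ℝ} (hA0 : ∀ s t, 0 ≤ A s t) (hA1 : ∀ s, ∑ t, A s t = 1)
    {B : ℕ → Matrix S S ℝ} (hB0 : ∀ j s t, 0 ≤ B j s t) (hB1 : ∀ j s, ∑ t, B j s t = 1)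
    {δ : ℝ} (hδ : 0 ≤ δ) (hclose : ∀ j s t, |B j s t - A s t| ≤ δ) {x : ℕ → S → ℝ}
    (hx : ∑ s, |x 0 s| ≤ 1) (hstep : ∀ j, x (j + 1) = Matrix.vecMul (x j) (B j)) (j : ℕ) :
    ∑ t, |x j t - Matrix.vecMul (x 0) (A ^ j) t| ≤ j * (Fintype.card S * δ) := by
  have hnorm : ∀ j, ∑ s, |x j s| ≤ 1 := by
    intro j
    induction j with
    | zero => exact hx
    | succ j ih =>
      rw [hstep]
      exact (Matrix.sum_abs_vecMul_le_of_row_stochastic (hB0 j) (hB1 j) _).trans ih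
  induction j with
  | zero => simp
  | succ j ih =>
    have hsplit : x (j + 1) - Matrix.vecMul (x 0) (A ^ (j + 1)) =
        Matrix.vecMul (x j) (B j - A) +
          Matrix.vecMul (x j - Matrix.vecMul (x 0) (A ^ j)) A := by
      rw [hstep, Matrix.vecMul_sub, Matrix.sub_vecMul, Matrix.vecMul_vecMul, pow_succ]
      abel
    have hperturb : ∑ t, |Matrix.vecMul (x j) (B j - A) t| ≤ Fintype.card S * δ :=
      (Matrix.sum_abs_vecMul_le_of_abs_le (hclose j) (x j)).trans
        (mul_le_of_le_one_right (by positivity) (hnorm j))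
    have hcontract := (Matrix.sum_abs_vecMul_le_of_row_stochastic hA0 hA1
      (x j - Matrix.vecMul (x 0) (A ^ j))).trans ih
    calc ∑ t, |x (j + 1) t - Matrix.vecMul (x 0) (A ^ (j + 1)) t|
        ≤ ∑ t, (|Matrix.vecMul (x j) (B j - A) t| +
            |Matrix.vecMul (x j - Matrix.vecMul (x 0) (A ^ j)) A t|) := by
          refine Finset.sum_le_sum fun t _ => ?_
          rw [← Pi.sub_apply, hsplit]
          exact abs_add_le _ _
      _ ≤ (j + 1 : ℕ) * (Fintype.card S * δ) := by
          rw [Finset.sum_add_distrib]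
          push_cast
          linarith


/-- Lemma 5 (Appendix B): let `A` be an `n × n` row-stochastic matrix and `{A_k}` a
sequence of row-stochastic matrices with `sup_k ‖A_k − A‖∞ ≤ ε/(2nm)` for some
`ε ∈ (0,1)` and `m ≥ 1`. Then for every `k` and every probability vector `μ₀`,
`‖μ₀ A_k A_{k+1} ⋯ A_{k+m−1} − μ₀ Aᵐ‖₁ ≤ ε/2`. (Here `seq j = μ₀ A_k ⋯ A_{k+j−1}`.) -/
theorem perturbed_finite_products_close
    {S : Type*} [Fintype S] [Nonempty S] [DecidableEq S]
    (A : Matrix S S ℝ) (hA0 : ∀ s t, 0 ≤ A s t) (hA1 : ∀ s, ∑ t, A s t = 1)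
    (Ak : ℕ → Matrix S S ℝ)
    (hAk0 : ∀ k s t, 0 ≤ Ak k s t) (hAk1 : ∀ k s, ∑ t, Ak k s t = 1)
    (ε : ℝ) (hε : ε ∈ Set.Ioo (0 : ℝ) 1) (m : ℕ) (hm : 1 ≤ m)
    (hclose : ∀ k s t, |Ak k s t - A s t| ≤ ε / (2 * (Fintype.card S : ℝ) * (m : ℝ))) :
    ∀ k : ℕ, ∀ μ0 : S → ℝ, (∀ s, 0 ≤ μ0 s) → (∑ s, μ0 s = 1) →
      ∀ seq : ℕ → S → ℝ, seq 0 = μ0 →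
        (∀ j, seq (j + 1) = fun t => ∑ s, seq j s * Ak (k + j) s t) →
        ∑ t, |seq m t - Matrix.vecMul μ0 (A ^ m) t| ≤ ε / 2 := by
  intro k μ0 hμ0 hμ1 seq hseq0 hstep
  have hcard : (0 : ℝ) < Fintype.card S := by exact_mod_cast Fintype.card_pos
  have hmpos : (0 : ℝ) < m := by exact_mod_cast hm
  have hεpos : 0 < ε := hε.1
  subst hseq0
  have hbound := Matrix.sum_abs_sub_vecMul_pow_le hA0 hA1 (B := fun j => Ak (k + j))
    (fun j => hAk0 (k + j)) (fun j => hAk1 (k + j)) (by positivity)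
    (fun j => hclose (k + j)) (x := seq) (by simp [abs_of_nonneg, hμ0, hμ1]) hstep m
  refine hbound.trans_eq ?_
  field_simp
end
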